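/- Let 𝒰, 𝒱, 𝒴 be nonempty finite sets, let e be a symbol not in 𝒱, and let p be a probability mass function on 𝒰 × 𝒱 × 𝒴. For ε ∈ [0,1] define the probability mass function p_ε on 𝒰 × (𝒱 ∪ {e}) × 𝒴 by p_ε(u, v, y) = (1 − ε)·p(u, v, y) for v ∈ 𝒱 and p_ε(u, e, y) = ε·Σ_{v∈𝒱} p(u, v, y). Let I_ε denote the mutual information I((U,Ṽ);Y) computed under p_ε, where (U,Ṽ,Y) ∼ p_ε. Then the map ε ↦ I_ε is continuous on [0,1], I_0 = I(U,V;Y) computed under p, and I_1 = I(U;Y) computed under p. Consequently, if I(U,V;Y) > I(U,V;S)-type endpoint conditions hold in the form I_0 − J_0 > 0 and I_1 − J_1 < 0, where J_ε is defined analogously from a second pmf q on 𝒰 × 𝒱 × 𝒮 with the same erasure construction, there exists ε ∈ [0,1] with I_ε = J_ε. -/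

import Mathlib

open Finset

/-- Mutual information `I(X;Y)` of a joint probability mass function `p` on `𝒳 × 𝒴`
(with the conventions `0·log(·) = 0`, `log 0 = 0`, `x/0 = 0`). -/
noncomputable def miPmf {𝒳 𝒴 : Type*} [Fintype 𝒳] [Fintype 𝒴] (p : 𝒳 × 𝒴 → ℝ) : ℝ :=
  ∑ x : 𝒳, ∑ y : 𝒴, p (x, y) *
    Real.log (p (x, y) / ((∑ y' : 𝒴, p (x, y')) * (∑ x' : 𝒳, p (x', y))))

/-- The pmf on `𝒰 × (𝒱 ∪ {e}) × 𝒲` obtained from a pmf `p` on `𝒰 × 𝒱 × 𝒲` by passing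
the `𝒱`-component through an erasure channel with erasure probability `ε`; the erasure
symbol `e` is modelled by `none : Option 𝒱`. -/
noncomputable def erasePmf {𝒰 𝒱 𝒲 : Type*} [Fintype 𝒱] (p : 𝒰 × 𝒱 × 𝒲 → ℝ) (ε : ℝ) :
    𝒰 × Option 𝒱 × 𝒲 → ℝ := fun t =>
  match t with
  | (u, some v, w) => (1 - ε) * p (u, v, w)
  | (u, none, w) => ε * ∑ v : 𝒱, p (u, v, w)

/-- `I_ε = I((U,Ṽ);W)` computed under the erased pmf `p_ε`. -/
noncomputable def eraseMI {𝒰 𝒱 𝒲 : Type*} [Fintype 𝒰] [Fintype 𝒱] [Fintype 𝒲]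
    (p : 𝒰 × 𝒱 × 𝒲 → ℝ) (ε : ℝ) : ℝ :=
  miPmf (fun t : (𝒰 × Option 𝒱) × 𝒲 => erasePmf p ε (t.1.1, t.1.2, t.2))

lemma mul_mul_log_mul_div (c a b m : ℝ) :
    c * a * Real.log (c * a / (c * b * m)) = c * (a * Real.log (a / (b * m))) := by
  rcases eq_or_ne c 0 with rfl | hc
  · simp
  · rw [mul_assoc c b m, mul_div_mul_left _ _ hc, mul_assoc]

/-- Erasure leaves the marginal on `𝒲` unchanged. -/
lemma sum_erasePmf {𝒰 𝒱 𝒲 : Type*} [Fintype 𝒰] [Fintype 𝒱]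
    (p : 𝒰 × 𝒱 × 𝒲 → ℝ) (ε : ℝ) (w : 𝒲) :
    ∑ x : 𝒰 × Option 𝒱, erasePmf p ε (x.1, x.2, w) = ∑ u, ∑ v, p (u, v, w) := by
  simp only [Fintype.sum_prod_type, Fintype.sum_option, erasePmf, ← mul_sum]
  exact sum_congr rfl fun u _ => by ring

/-- The mutual information after erasure interpolates linearly between `I(U,V;W)` and
`I(U;W)`. -/
lemma eraseMI_eq {𝒰 𝒱 𝒲 : Type*} [Fintype 𝒰] [Fintype 𝒱] [Fintype 𝒲]
    (p : 𝒰 × 𝒱 × 𝒲 → ℝ) (ε : ℝ) :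
    eraseMI p ε =
      (1 - ε) * miPmf (fun t : (𝒰 × 𝒱) × 𝒲 => p (t.1.1, t.1.2, t.2)) +
        ε * miPmf (fun t : 𝒰 × 𝒲 => ∑ v : 𝒱, p (t.1, v, t.2)) := by
  simp only [eraseMI, miPmf, sum_erasePmf]
  simp only [Fintype.sum_prod_type, Fintype.sum_option, erasePmf, ← mul_sum,
    mul_mul_log_mul_div, sum_add_distrib]
  ring

lemma continuous_eraseMI {𝒰 𝒱 𝒲 : Type*} [Fintype 𝒰] [Fintype 𝒱] [Fintype 𝒲]
    (p : 𝒰 × 𝒱 × 𝒲 → ℝ) : Continuous (eraseMI p) := by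
  rw [funext (eraseMI_eq p)]
  fun_prop

/-- The erasure-channel continuity argument: `ε ↦ I_ε` is continuous on `[0,1]`,
`I_0 = I(U,V;Y)`, `I_1 = I(U;Y)`, and consequently, if `I_0 − J_0 > 0` and
`I_1 − J_1 < 0` (with `J_ε` defined analogously from a second pmf `q`), then by the
intermediate value theorem there exists `ε ∈ [0,1]` with `I_ε = J_ε`. -/
theorem erasure_continuity_and_IVT
    {𝒰 𝒱 𝒴 𝒮 : Type*} [Fintype 𝒰] [Fintype 𝒱] [Fintype 𝒴] [Fintype 𝒮]
    [Nonempty 𝒰] [Nonempty 𝒱] [Nonempty 𝒴]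
    (p : 𝒰 × 𝒱 × 𝒴 → ℝ) (hp0 : ∀ t, 0 ≤ p t) (hp1 : ∑ t, p t = 1)
    (q : 𝒰 × 𝒱 × 𝒮 → ℝ) (hq0 : ∀ t, 0 ≤ q t) (hq1 : ∑ t, q t = 1) :
    ContinuousOn (eraseMI p) (Set.Icc (0 : ℝ) 1) ∧
      eraseMI p 0 = miPmf (fun t : (𝒰 × 𝒱) × 𝒴 => p (t.1.1, t.1.2, t.2)) ∧
      eraseMI p 1 = miPmf (fun t : 𝒰 × 𝒴 => ∑ v : 𝒱, p (t.1, v, t.2)) ∧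
      (0 < eraseMI p 0 - eraseMI q 0 → eraseMI p 1 - eraseMI q 1 < 0 →
        ∃ ε ∈ Set.Icc (0 : ℝ) 1, eraseMI p ε = eraseMI q ε) := by
  refine ⟨(continuous_eraseMI p).continuousOn, by simp [eraseMI_eq], by simp [eraseMI_eq],
    fun h₀ h₁ => ?_⟩
  obtain ⟨ε, hε, h⟩ := intermediate_value_Icc' zero_le_one
    ((continuous_eraseMI p).sub (continuous_eraseMI q)).continuousOn ⟨h₁.le, h₀.le⟩
  exact ⟨ε, hε, sub_eq_zero.mp h⟩
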